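/- arXiv:math/0611375 — 9 statements merged into one kernel-verified Lean document; each statement's English description precedes it below -/
import Mathlib

section
/- The bilinear alternating map α(f,g) := f′·g″ − f″·g′ is a 2-cocycle of W₁ with values in F₁: for all f, g, h ∈ ℂ[x], f ∘₁ α(g,h) + g ∘₁ α(h,f) + h ∘₁ α(f,g) = α(⁅f,g⁆, h) + α(⁅g,h⁆, f) + α(⁅h,f⁆, g), where f ∘₁ b = f·b′ + f′·b is the F₁-action and ⁅f,g⁆ = f·g′ − g·f′. -/
open Polynomial

/-- `α(f,g) = f′·g″ − f″·g′`. -/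
noncomputable def alphaGV (f g : Polynomial ℂ) : Polynomial ℂ :=
  derivative f * derivative (derivative g) - derivative (derivative f) * derivative g

/-- The `F₁`-action `f ∘₁ b = f·b′ + f′·b`. -/
noncomputable def actF1 (f b : Polynomial ℂ) : Polynomial ℂ :=
  f * derivative b + derivative f * b

/-- `α(f,g) = f′·g″ − f″·g′` is a 2-cocycle of `W₁` with values in `F₁`:
`f ∘₁ α(g,h) + g ∘₁ α(h,f) + h ∘₁ α(f,g) = α(⁅f,g⁆,h) + α(⁅g,h⁆,f) + α(⁅h,f⁆,g)`. -/
theorem alphaGV_is_two_cocycle (f g h : Polynomial ℂ) :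
    actF1 f (alphaGV g h) + actF1 g (alphaGV h f) + actF1 h (alphaGV f g)
      = alphaGV (f * derivative g - g * derivative f) h
        + alphaGV (g * derivative h - h * derivative g) f
        + alphaGV (h * derivative f - f * derivative h) g := by
  simp only [actF1, alphaGV, derivative_sub, derivative_add, derivative_mul]
  ring
end

section
/- The bilinear alternating map c(f,g) := f·g′ − f′·g is a 2-cocycle of W₁ with values in F₀: for all f, g, h ∈ ℂ[x], f ∘₀ c(g,h) + g ∘₀ c(h,f) + h ∘₀ c(f,g) = c(⁅f,g⁆, h) + c(⁅g,h⁆, f) + c(⁅h,f⁆, g), where f ∘₀ a = f·a′ is the F₀-action and ⁅f,g⁆ = f·g′ − g·f′. -/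
open Polynomial

/-- `c(f,g) = f·g′ − f′·g`. -/
noncomputable def etaCocycle (f g : Polynomial ℂ) : Polynomial ℂ :=
  f * derivative g - derivative f * g

/-- The `F₀`-action `f ∘₀ a = f·a′`. -/
noncomputable def actF0 (f a : Polynomial ℂ) : Polynomial ℂ :=
  f * derivative a

/-- `c(f,g) = f·g′ − f′·g` is a 2-cocycle of `W₁` with values in `F₀`:
`f ∘₀ c(g,h) + g ∘₀ c(h,f) + h ∘₀ c(f,g) = c(⁅f,g⁆,h) + c(⁅g,h⁆,f) + c(⁅h,f⁆,g)`. -/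
theorem etaCocycle_is_two_cocycle (f g h : Polynomial ℂ) :
    actF0 f (etaCocycle g h) + actF0 g (etaCocycle h f) + actF0 h (etaCocycle f g)
      = etaCocycle (f * derivative g - g * derivative f) h
        + etaCocycle (g * derivative h - h * derivative g) f
        + etaCocycle (h * derivative f - f * derivative h) g := by
  simp only [actF0, etaCocycle, derivative_sub, derivative_mul]
  ring
end

section
/- For all f, g, h ∈ ℂ[x], the derivative of the polynomial θ(f,g,h) equals α(⁅f,g⁆, h) + α(⁅g,h⁆, f) + α(⁅h,f⁆, g), where α(u,v) = u′·v″ − u″·v′ and ⁅f,g⁆ = f·g′ − g·f′. (This expresses the identity d_{DR} θ(x) = d α underlying the Godbillon–Vey descent.) -/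
open Polynomial

/-- `θ(f,g,h)` : the 3×3 Wronskian-type determinant with rows
`(f,g,h)`, `(f′,g′,h′)`, `(f″,g″,h″)`. -/
noncomputable def thetaGV (f g h : Polynomial ℂ) : Polynomial ℂ :=
  Matrix.det !![f, g, h;
                derivative f, derivative g, derivative h;
                derivative (derivative f), derivative (derivative g), derivative (derivative h)]

/-- `d_{DR} θ = d α`: the derivative of `θ(f,g,h)` equals
`α(⁅f,g⁆,h) + α(⁅g,h⁆,f) + α(⁅h,f⁆,g)`. -/
theorem derivative_thetaGV (f g h : Polynomial ℂ) :
    derivative (thetaGV f g h)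
      = alphaGV (f * derivative g - g * derivative f) h
        + alphaGV (g * derivative h - h * derivative g) f
        + alphaGV (h * derivative f - f * derivative h) g := by
  simp only [thetaGV, alphaGV, Matrix.det_fin_three, Matrix.of_apply, Matrix.cons_val',
    Matrix.cons_val_zero, Matrix.cons_val_one, Matrix.cons_val, derivative_add, derivative_sub,
    derivative_mul]
  ring
end

section
/- Let B : ℂ[x] × ℂ[x] → ℂ[x] be any map such that for all u, v the derivative of B(u,v) equals α(u,v) and B(u,v) has constant coefficient 0. Then for all f, g, h ∈ ℂ[x], f·α(g,h) + g·α(h,f) + h·α(f,g) − B(⁅f,g⁆, h) − B(⁅g,h⁆, f) − B(⁅h,f⁆, g) is the constant polynomial whose value is θ(0)(f,g,h), the evaluation at x = 0 of the determinant θ(f,g,h). (Equivalently: the Chevalley–Eilenberg coboundary with values in F₀ of any primitive of the 2-cocycle α, vanishing at 0, is the Godbillon–Vey cocycle θ(0).) -/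
open Polynomial

/-- The Godbillon–Vey determinant expanded along its first row. -/
theorem thetaGV_eq (f g h : Polynomial ℂ) :
    thetaGV f g h = f * alphaGV g h + g * alphaGV h f + h * alphaGV f g := by
  simp only [thetaGV, alphaGV, Matrix.det_fin_three, Matrix.of_apply, Matrix.cons_val]
  ring

/-- If `B(u,v)` is a primitive of `α(u,v)` with zero constant term, then the
Chevalley–Eilenberg coboundary (with values in `F₀`) of `B` is the constant polynomial
whose value is the Godbillon–Vey cocycle `θ(0)(f,g,h)`. -/
theorem coboundary_of_primitive_eq_GV (B : Polynomial ℂ → Polynomial ℂ → Polynomial ℂ)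
    (hB : ∀ u v, derivative (B u v) = alphaGV u v)
    (hB0 : ∀ u v, (B u v).coeff 0 = 0) (f g h : Polynomial ℂ) :
    f * alphaGV g h + g * alphaGV h f + h * alphaGV f g
      - B (f * derivative g - g * derivative f) h
      - B (g * derivative h - h * derivative g) f
      - B (h * derivative f - f * derivative h) g
      = C ((thetaGV f g h).eval 0) := by
  rw [← thetaGV_eq]
  have hder : derivative (thetaGV f g h
      - B (f * derivative g - g * derivative f) h
      - B (g * derivative h - h * derivative g) f
      - B (h * derivative f - f * derivative h) g) = 0 := by
    rw [derivative_sub, derivative_sub, derivative_sub, hB, hB, hB, derivative_thetaGV]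
    ring
  rw [eq_C_of_derivative_eq_zero hder]
  simp only [coeff_sub, hB0, sub_zero, ← coeff_zero_eq_eval_zero]
end

section
/- (Lemma 4.) For all X, Y, Z ∈ sl₂(ℂ), the restriction of the Godbillon–Vey cocycle along ρ satisfies θ(0)(ρ(X), ρ(Y), ρ(Z)) = −(1/2)·κ(⁅X,Y⁆, Z), where κ is the Killing form of sl₂(ℂ). In particular the restriction of θ(0) to sl₂(ℂ) ⊂ W₁ is a non-zero scalar multiple of the cocycle ⟨⁅·,·⁆, ·⟩ built from the Killing form. -/
open Polynomial

/-- The embedding `sl₂(ℂ) → W₁`, sending `[[a,b],[c,−a]]` to `−c + 2a·x + b·x²`. -/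
noncomputable def rhoSL2 (A : LieAlgebra.SpecialLinear.sl (Fin 2) ℂ) : Polynomial ℂ :=
  C (-(A.val 1 0)) + C (2 * A.val 0 0) * X + C (A.val 0 1) * X ^ 2

/-- The Godbillon–Vey cocycle `θ(0)` : evaluation at `x = 0` of `θ(f,g,h)`. -/
noncomputable def thetaGV0 (f g h : Polynomial ℂ) : ℂ := (thetaGV f g h).eval 0

namespace LieAlgebra.SpecialLinear

variable {R : Type*} [CommRing R]

theorem sl_two_val_one_one (A : sl (Fin 2) R) : A.val 1 1 = -A.val 0 0 := by
  have h : Matrix.trace A.val = 0 := A.property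
  rw [Matrix.trace_fin_two] at h
  linear_combination h

/-- The coordinates `(a, b, c)` of the traceless matrix `[[a, b], [c, -a]]`. -/
def slTwoCoords (R : Type*) [CommRing R] : sl (Fin 2) R ≃ₗ[R] (Fin 3 → R) where
  toFun A := ![A.val 0 0, A.val 0 1, A.val 1 0]
  map_add' A B := by
    ext i
    fin_cases i <;> simp
  map_smul' r A := by
    ext i
    fin_cases i <;> simp
  invFun v := ⟨!![v 0, v 1; v 2, -v 0], by
    change Matrix.trace (_ : Matrix (Fin 2) (Fin 2) R) = 0
    simp [Matrix.trace_fin_two]⟩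
  left_inv A := by
    ext i j
    fin_cases i <;> fin_cases j <;> simp [sl_two_val_one_one]
  right_inv v := by
    ext i
    fin_cases i <;> simp

/-- The standard basis `h, e, f` of `sl₂`. -/
noncomputable def slTwoBasis (R : Type*) [CommRing R] : Module.Basis (Fin 3) R (sl (Fin 2) R) :=
  .ofEquivFun (slTwoCoords R)

/-- The Killing form of `sl₂` is four times the trace form of its defining representation. -/
theorem killingForm_sl_two (A B : sl (Fin 2) R) :
    killingForm R (sl (Fin 2) R) A B = 4 * Matrix.trace (A.val * B.val) := by
  rw [killingForm_apply_apply, LinearMap.trace_eq_matrix_trace R (slTwoBasis R)]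
  simp [Matrix.trace_fin_three, Matrix.trace_fin_two, LinearMap.toMatrix_apply, slTwoBasis,
    slTwoCoords, Ring.lie_def, Matrix.mul_apply, Matrix.vecMul, dotProduct, Fin.sum_univ_two,
    sl_two_val_one_one]
  ring

end LieAlgebra.SpecialLinear

/-- (Lemma 4.) The restriction of the Godbillon–Vey cocycle along `ρ : sl₂(ℂ) → W₁`
is `−(1/2)` times the cocycle `⟨⁅·,·⁆,·⟩` built from the Killing form `κ` of `sl₂(ℂ)`;
in particular it is a non-zero scalar multiple of it. -/
theorem thetaGV0_restricted_to_sl2 (A B D : LieAlgebra.SpecialLinear.sl (Fin 2) ℂ) :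
    thetaGV0 (rhoSL2 A) (rhoSL2 B) (rhoSL2 D)
      = -(1 / 2 : ℂ) * killingForm ℂ (LieAlgebra.SpecialLinear.sl (Fin 2) ℂ) ⁅A, B⁆ D := by
  rw [LieAlgebra.SpecialLinear.killingForm_sl_two]
  simp [thetaGV0, thetaGV, rhoSL2, Matrix.det_fin_three, Matrix.trace_fin_two, Matrix.mul_apply,
    Fin.sum_univ_two, Ring.lie_def, LieAlgebra.SpecialLinear.sl_two_val_one_one]
  ring
end

section
/- The W₁-module F₁ is irreducible: if M ⊆ ℂ[x] is a linear subspace invariant under the F₁-action (i.e. f·a′ + f′·a ∈ M for every f ∈ ℂ[x] and a ∈ M), then M = 0 or M = ℂ[x]. -/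
open Polynomial

/-- A nonzero subspace stable under differentiation contains the constant polynomial `1`. -/
theorem one_mem_of_derivative_mem {K : Type*} [Field K] [CharZero K] (M : Submodule K K[X])
    (hM : ∀ a ∈ M, derivative a ∈ M) {a : K[X]} (ha : a ∈ M) (ha0 : a ≠ 0) : 1 ∈ M := by
  induction hn : a.natDegree using Nat.strong_induction_on generalizing a with
  | _ n ih =>
    rcases Nat.eq_zero_or_pos n with rfl | hpos
    · obtain ⟨c, rfl⟩ := natDegree_eq_zero.mp hn
      have hc : c ≠ 0 := fun h => ha0 (by simp [h])
      have := M.smul_mem c⁻¹ ha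
      rwa [smul_C, smul_eq_mul, inv_mul_cancel₀ hc, C_1] at this
    · have hd : a.natDegree ≠ 0 := by omega
      refine ih _ (hn ▸ natDegree_derivative_lt hd) (hM a ha) (fun h => ?_) rfl
      exact hd (derivative_eq_zero.mp h)

/-- A subspace containing every derivative is the whole polynomial ring in characteristic zero. -/
theorem eq_top_of_forall_derivative_mem {K : Type*} [Field K] [CharZero K] (M : Submodule K K[X])
    (hM : ∀ f : K[X], derivative f ∈ M) : M = ⊤ := by
  refine eq_top_iff.mpr fun p _ => ?_
  induction p using Polynomial.induction_on' with
  | add p q hp hq => exact M.add_mem (hp trivial) (hq trivial)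
  | monomial n c =>
    have hn : (n : K) + 1 ≠ 0 := Nat.cast_add_one_ne_zero n
    have := hM (monomial (n + 1) (c / (n + 1)))
    rwa [derivative_monomial, Nat.cast_add_one, div_mul_cancel₀ _ hn, Nat.add_sub_cancel] at this

/-- The `W₁`-module `F₁` is irreducible: a subspace of `ℂ[x]` invariant under the
action `f ∘₁ a = f·a′ + f′·a` is either `0` or all of `ℂ[x]`. -/
theorem F1_irreducible (M : Submodule ℂ (Polynomial ℂ))
    (hM : ∀ (f a : Polynomial ℂ), a ∈ M → f * derivative a + derivative f * a ∈ M) :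
    M = ⊥ ∨ M = ⊤ := by
  refine or_iff_not_imp_left.mpr fun hne => ?_
  obtain ⟨a, ha, ha0⟩ := M.exists_mem_ne_zero_of_ne_bot hne
  have h1 : (1 : ℂ[X]) ∈ M :=
    one_mem_of_derivative_mem M (fun b hb => by simpa using hM 1 b hb) ha ha0
  exact eq_top_of_forall_derivative_mem M fun f => by simpa using hM f 1 h1
end

section
/- The W₁-module F₀ has exactly one nonzero proper submodule, namely the constants: if M ⊆ ℂ[x] is a linear subspace invariant under the F₀-action (i.e. f·a′ ∈ M for every f ∈ ℂ[x] and a ∈ M), then M = 0, or M = ℂ·1 (the constant polynomials), or M = ℂ[x]. -/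
open Polynomial

/-- An `F₀`-submodule of `ℂ[x]` containing a nonconstant polynomial is everything. -/
theorem F0_submodule_eq_top (M : Submodule ℂ ℂ[X])
    (hM : ∀ (f a : ℂ[X]), a ∈ M → f * derivative a ∈ M)
    {a : ℂ[X]} (ha : a ∈ M) (hdeg : a.natDegree ≠ 0) : M = ⊤ := by
  obtain ⟨n, hn⟩ := Nat.exists_eq_succ_of_ne_zero hdeg
  induction n generalizing a with
  | zero =>
    obtain ⟨c, hc, d, rfl⟩ := natDegree_eq_one.mp hn
    refine Submodule.eq_top_iff'.mpr fun f => ?_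
    have hf := hM (f * C c⁻¹) _ ha
    have hcc : (C c⁻¹ : ℂ[X]) * C c = 1 := by rw [← C_mul, inv_mul_cancel₀ hc, C_1]
    simpa [mul_assoc, hcc] using hf
  | succ n ih =>
    have hd : (derivative a).natDegree = n + 1 := by
      rw [natDegree_derivative, hn]
      rfl
    exact ih (by simpa using hM 1 a ha) (by omega) hd

/-- The `W₁`-module `F₀` has exactly one nonzero proper submodule, the constants:
a subspace of `ℂ[x]` invariant under the action `f ∘₀ a = f·a′` is `0`, the constants
`ℂ·1`, or all of `ℂ[x]`. -/
theorem F0_submodules (M : Submodule ℂ (Polynomial ℂ))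
    (hM : ∀ (f a : Polynomial ℂ), a ∈ M → f * derivative a ∈ M) :
    M = ⊥ ∨ M = Submodule.span ℂ ({1} : Set (Polynomial ℂ)) ∨ M = ⊤ := by
  by_cases h : ∃ a ∈ M, a.natDegree ≠ 0
  · obtain ⟨a, ha, hdeg⟩ := h
    exact Or.inr (Or.inr (F0_submodule_eq_top M hM ha hdeg))
  · push Not at h
    have hle : M ≤ Submodule.span ℂ {1} := fun a ha => by
      obtain ⟨c, rfl⟩ := natDegree_eq_zero.mp (h a ha)
      exact Submodule.mem_span_singleton.mpr ⟨c, by rw [smul_eq_C_mul, mul_one]⟩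
    rcases (nonzero_span_atom (1 : ℂ[X]) one_ne_zero).le_iff.mp hle with h | h
    · exact Or.inl h
    · exact Or.inr (Or.inl h)
end

section
/- Let μ : 𝔪 → 𝔫 be a crossed module of Lie algebras with action η, let 𝔤 := 𝔫 / im μ with quotient map π, let ρ : 𝔤 → 𝔫 be a linear section of π (π ∘ ρ = id), and let β : 𝔤 × 𝔤 → 𝔪 be a bilinear alternating map with μ(β(x,y)) = ⁅ρ(x), ρ(y)⁆ − ρ(⁅x,y⁆) for all x, y ∈ 𝔤. Then for all x₁, x₂, x₃ ∈ 𝔤, μ( η(ρ(x₁))(β(x₂,x₃)) − η(ρ(x₂))(β(x₁,x₃)) + η(ρ(x₃))(β(x₁,x₂)) − β(⁅x₁,x₂⁆, x₃) + β(⁅x₁,x₃⁆, x₂) − β(⁅x₂,x₃⁆, x₁) ) = 0; that is, the 3-cochain γ := d^𝔪 β takes values in ker μ. -/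
/-- For a crossed module `μ : 𝔪 → 𝔫` with action `η`, quotient `𝔤 = 𝔫 / im μ` with
projection `π`, a linear section `ρ` of `π` and a bilinear alternating `β : 𝔤 × 𝔤 → 𝔪`
with `μ(β(x,y)) = ⁅ρ(x),ρ(y)⁆ − ρ(⁅x,y⁆)`, the 3-cochain `γ = d^𝔪 β` takes values in
`ker μ`. -/
theorem crossedModule_gamma_in_ker {k M N G : Type*} [Field k]
    [LieRing M] [LieAlgebra k M] [LieRing N] [LieAlgebra k N]
    [LieRing G] [LieAlgebra k G]
    (μ : M →ₗ⁅k⁆ N) (η : N →ₗ⁅k⁆ LieDerivation k M M)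
    (ha : ∀ (n : N) (m : M), μ (η n m) = ⁅n, μ m⁆)
    (hb : ∀ m m' : M, η (μ m) m' = ⁅m, m'⁆)
    -- 𝔤 = 𝔫 / im μ, with quotient map π
    (π : N →ₗ⁅k⁆ G) (hπ : Function.Surjective π)
    (hker : ∀ n : N, π n = 0 ↔ n ∈ μ.range)
    -- a linear section ρ of π
    (ρ : G →ₗ[k] N) (hρ : ∀ x : G, π (ρ x) = x)
    -- a bilinear alternating β with μ ∘ β measuring the failure of ρ to be a hom
    (β : G → G → M)
    (hβadd₁ : ∀ x y z : G, β (x + y) z = β x z + β y z)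
    (hβadd₂ : ∀ x y z : G, β x (y + z) = β x y + β x z)
    (hβsmul₁ : ∀ (c : k) (x y : G), β (c • x) y = c • β x y)
    (hβsmul₂ : ∀ (c : k) (x y : G), β x (c • y) = c • β x y)
    (hβalt : ∀ x : G, β x x = 0)
    (hβ : ∀ x y : G, μ (β x y) = ⁅ρ x, ρ y⁆ - ρ ⁅x, y⁆) :
    ∀ x₁ x₂ x₃ : G,
      μ (η (ρ x₁) (β x₂ x₃) - η (ρ x₂) (β x₁ x₃) + η (ρ x₃) (β x₁ x₂)
          - β ⁅x₁, x₂⁆ x₃ + β ⁅x₁, x₃⁆ x₂ - β ⁅x₂, x₃⁆ x₁) = 0 := by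
  intro x₁ x₂ x₃
  have jacobi_N : ⁅ρ x₁, ⁅ρ x₂, ρ x₃⁆⁆ - ⁅ρ x₂, ⁅ρ x₁, ρ x₃⁆⁆ + ⁅ρ x₃, ⁅ρ x₁, ρ x₂⁆⁆ = 0 := by
    rw [leibniz_lie (ρ x₁) (ρ x₂) (ρ x₃), ← lie_skew (ρ x₃) ⁅ρ x₁, ρ x₂⁆]
    abel
  have jacobi_G : ρ ⁅⁅x₁, x₂⁆, x₃⁆ - ρ ⁅⁅x₁, x₃⁆, x₂⁆ + ρ ⁅⁅x₂, x₃⁆, x₁⁆ = 0 := by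
    rw [← map_sub, ← map_add, ← lie_skew ⁅x₁, x₃⁆ x₂, ← lie_skew ⁅x₂, x₃⁆ x₁,
      leibniz_lie x₁ x₂ x₃, ← map_zero ρ]
    congr 1
    abel
  simp only [map_add, map_sub, ha, hβ, lie_sub]
  rw [← lie_skew (ρ ⁅x₁, x₂⁆) (ρ x₃), ← lie_skew (ρ ⁅x₁, x₃⁆) (ρ x₂),
    ← lie_skew (ρ ⁅x₂, x₃⁆) (ρ x₁), ← add_zero (0 : N)]
  nth_rewrite 1 [← jacobi_N]
  rw [← jacobi_G]
  abel
end

section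
/- (Section 3.1 construction.) On E := ℂ[x] × ℂ[x] (first factor the density module F₁, second factor the Lie algebra W₁) define ⁅(a,f), (b,g)⁆ := (f·b′ + f′·b − g·a′ − g′·a + α(f,g), f·g′ − g·f′) with α(f,g) = f′·g″ − f″·g′. Then: (i) this bracket makes E a Lie algebra (the abelian extension F₁ ×_α W₁); (ii) the map μ : ℂ[x] → E, μ(a) := (a′, 0) (the formal de Rham differential F₀ → F₁ followed by inclusion) satisfies ⁅μ(a), μ(b)⁆ = 0; (iii) with the action η(b,g)(a) := g·a′ of E on F₀, one has μ(η(b,g)(a)) = ⁅(b,g), μ(a)⁆ and η(μ(a))(a′) = 0; hence μ : F₀ → F₁ ×_α W₁ with action η is a crossed module of Lie algebras whose kernel is the constants ℂ·1 and whose cokernel is W₁. -/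
open Polynomial

/-- The bracket of the abelian extension `E = F₁ ×_α W₁`:
`⁅(a,f),(b,g)⁆ = (f∘₁b − g∘₁a + α(f,g), ⁅f,g⁆)`. -/
noncomputable def brE (p q : Polynomial ℂ × Polynomial ℂ) : Polynomial ℂ × Polynomial ℂ :=
  (p.2 * derivative q.1 + derivative p.2 * q.1
      - q.2 * derivative p.1 - derivative q.2 * p.1 + alphaGV p.2 q.2,
   p.2 * derivative q.2 - q.2 * derivative p.2)

/-- The map `μ : F₀ → E`, `a ↦ (a′, 0)` (the de Rham differential followed by
inclusion). -/
noncomputable def muE (a : Polynomial ℂ) : Polynomial ℂ × Polynomial ℂ :=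
  (derivative a, 0)

theorem Polynomial.derivative_surjective {K : Type*} [Field K] [CharZero K] :
    Function.Surjective (derivative : K[X] →ₗ[K] K[X]) := by
  intro p
  induction p using Polynomial.induction_on' with
  | add p q hp hq =>
    obtain ⟨a, rfl⟩ := hp
    obtain ⟨b, rfl⟩ := hq
    exact ⟨a + b, map_add _ _ _⟩
  | monomial n c =>
    have hn : (n : K) + 1 ≠ 0 := Nat.cast_add_one_ne_zero n
    refine ⟨monomial (n + 1) (c / (n + 1)), ?_⟩
    simp [hn]

theorem brE_jacobi (p q r : Polynomial ℂ × Polynomial ℂ) :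
    brE (brE p q) r + brE (brE q r) p + brE (brE r p) q = 0 := by
  ext1 <;>
  · simp only [brE, alphaGV, Prod.fst_add, Prod.snd_add, Prod.fst_zero, Prod.snd_zero,
      derivative_add, derivative_sub, derivative_mul]
    ring

theorem muE_eq_zero_iff_mem_span_one (a : Polynomial ℂ) :
    muE a = 0 ↔ a ∈ Submodule.span ℂ ({1} : Set (Polynomial ℂ)) := by
  rw [Submodule.mem_span_singleton, muE, Prod.mk_eq_zero]
  constructor
  · rintro ⟨h, -⟩
    refine ⟨a.coeff 0, ?_⟩
    rw [smul_eq_C_mul, mul_one]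
    exact (eq_C_of_derivative_eq_zero h).symm
  · rintro ⟨c, rfl⟩
    simp

theorem range_muE : Set.range muE = {p : Polynomial ℂ × Polynomial ℂ | p.2 = 0} := by
  ext ⟨b, g⟩
  constructor
  · rintro ⟨a, ha⟩
    exact (congrArg Prod.snd ha).symm
  · rintro (rfl : g = 0)
    obtain ⟨a, rfl⟩ := derivative_surjective b
    exact ⟨a, rfl⟩

/-- (Section 3.1.) `E = F₁ ×_α W₁` is a Lie algebra, `μ(a) = (a′,0)` is a homomorphism
from the abelian Lie algebra `F₀`, and with the action `η(b,g)(a) = g·a′` of `E` on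
`F₀`, `μ : F₀ → F₁ ×_α W₁` is a crossed module whose kernel is the constants `ℂ·1`
and whose cokernel is `W₁` (the range of `μ` being exactly the first factor, so that
the second projection identifies `coker μ` with `W₁`). -/
theorem GV_crossed_module :
    -- (i) `brE` makes `E` a Lie algebra
    (∀ p q r : Polynomial ℂ × Polynomial ℂ, brE (p + q) r = brE p r + brE q r)
    ∧ (∀ p q r : Polynomial ℂ × Polynomial ℂ, brE p (q + r) = brE p q + brE p r)
    ∧ (∀ (c : ℂ) (p q : Polynomial ℂ × Polynomial ℂ), brE (c • p) q = c • brE p q)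
    ∧ (∀ (c : ℂ) (p q : Polynomial ℂ × Polynomial ℂ), brE p (c • q) = c • brE p q)
    ∧ (∀ p : Polynomial ℂ × Polynomial ℂ, brE p p = 0)
    ∧ (∀ p q r : Polynomial ℂ × Polynomial ℂ,
        brE (brE p q) r + brE (brE q r) p + brE (brE r p) q = 0)
    -- (ii) μ is a homomorphism from the abelian Lie algebra F₀
    ∧ (∀ a b : Polynomial ℂ, brE (muE a) (muE b) = 0)
    -- (iii) crossed module conditions for the action η(b,g)(a) = g·a′
    ∧ (∀ (q : Polynomial ℂ × Polynomial ℂ) (a : Polynomial ℂ),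
        muE (q.2 * derivative a) = brE q (muE a))
    ∧ (∀ a b : Polynomial ℂ, (muE a).2 * derivative b = 0)
    -- the kernel of μ is the constants ℂ·1
    ∧ ({a : Polynomial ℂ | muE a = 0}
        = (Submodule.span ℂ ({1} : Set (Polynomial ℂ)) : Submodule ℂ (Polynomial ℂ)))
    -- the cokernel of μ is W₁ : the range of μ is the first factor F₁ × {0}
    ∧ (Set.range muE = {p : Polynomial ℂ × Polynomial ℂ | p.2 = 0}) := by
  refine ⟨fun p q r => ?_, fun p q r => ?_, fun c p q => ?_, fun c p q => ?_, fun p => ?_,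
    brE_jacobi, fun a b => ?_, fun q a => ?_, fun a b => ?_,
    Set.ext muE_eq_zero_iff_mem_span_one, range_muE⟩
  iterate 2
    ext1 <;>
    · simp only [brE, alphaGV, Prod.fst_add, Prod.snd_add, derivative_add]
      ring
  iterate 2
    ext1 <;>
    · simp only [brE, alphaGV, Prod.smul_fst, Prod.smul_snd, smul_eq_C_mul, derivative_C_mul]
      ring
  · ext1 <;>
    · simp only [brE, alphaGV, Prod.fst_zero, Prod.snd_zero]
      ring
  · simp [brE, muE, alphaGV]
  · ext1 <;>
    · simp only [brE, muE, alphaGV, derivative_mul, derivative_zero]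
      ring
  · simp [muE]
end
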